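/- Let X^δ ⊆ X and Y^δ ⊆ Y be subspaces and Q : Y → Y a bounded linear map with range contained in Y^δ and with (Bw)(μ − Qμ) = 0 for all w ∈ X^δ and μ ∈ Y (a Fortin operator). Define the data oscillation e_osc(g) := ‖g ∘ (Id − Q)‖_{Y'}. Then for every ε ≥ 0 and every w ∈ X^δ one has √(G_ε(w)) ≤ max(1, ‖Q‖)·√(G_ε^δ(w)) + e_osc(g). -/

import Mathlib

/-- The discrete dual norm `‖ℓ‖_{(Y^δ)'} = sup { ℓ μ : μ ∈ Y^δ, ‖μ‖ ≤ 1 }`. -/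
noncomputable def discreteDualNorm {Y : Type*} [NormedAddCommGroup Y]
    [InnerProductSpace ℝ Y] (Yδ : Submodule ℝ Y) (ℓ : Y →L[ℝ] ℝ) : ℝ :=
  sSup ((fun μ => ℓ μ) '' {μ : Y | μ ∈ Yδ ∧ ‖μ‖ ≤ 1})

theorem bddAbove_discreteDualNorm {Y : Type*} [NormedAddCommGroup Y]
    [InnerProductSpace ℝ Y] (Yδ : Submodule ℝ Y) (ℓ : Y →L[ℝ] ℝ) :
    BddAbove ((fun μ => ℓ μ) '' {μ : Y | μ ∈ Yδ ∧ ‖μ‖ ≤ 1}) := by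
  refine ⟨‖ℓ‖, ?_⟩
  rintro _ ⟨μ, ⟨-, hμ⟩, rfl⟩
  exact (le_abs_self _).trans (ℓ.unit_le_opNorm μ hμ)

theorem discreteDualNorm_nonneg {Y : Type*} [NormedAddCommGroup Y]
    [InnerProductSpace ℝ Y] (Yδ : Submodule ℝ Y) (ℓ : Y →L[ℝ] ℝ) :
    0 ≤ discreteDualNorm Yδ ℓ :=
  le_csSup (bddAbove_discreteDualNorm Yδ ℓ) ⟨0, ⟨Yδ.zero_mem, by simp⟩, map_zero ℓ⟩

theorem le_discreteDualNorm_mul_norm {Y : Type*} [NormedAddCommGroup Y]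
    [InnerProductSpace ℝ Y] {Yδ : Submodule ℝ Y} (ℓ : Y →L[ℝ] ℝ) {μ : Y} (hμ : μ ∈ Yδ) :
    ℓ μ ≤ discreteDualNorm Yδ ℓ * ‖μ‖ := by
  rcases eq_or_ne μ 0 with rfl | h0
  · simp
  have hpos : 0 < ‖μ‖ := norm_pos_iff.mpr h0
  have h : ℓ (‖μ‖⁻¹ • μ) ≤ discreteDualNorm Yδ ℓ :=
    le_csSup (bddAbove_discreteDualNorm Yδ ℓ)
      ⟨‖μ‖⁻¹ • μ, ⟨Yδ.smul_mem _ hμ, by simp [norm_smul, hpos.ne']⟩, rfl⟩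
  rwa [map_smul, smul_eq_mul, inv_mul_le_iff₀ hpos, mul_comm] at h

theorem abs_le_discreteDualNorm_mul_norm {Y : Type*} [NormedAddCommGroup Y]
    [InnerProductSpace ℝ Y] {Yδ : Submodule ℝ Y} (ℓ : Y →L[ℝ] ℝ) {μ : Y} (hμ : μ ∈ Yδ) :
    |ℓ μ| ≤ discreteDualNorm Yδ ℓ * ‖μ‖ := by
  refine abs_le'.mpr ⟨le_discreteDualNorm_mul_norm ℓ hμ, ?_⟩
  simpa using le_discreteDualNorm_mul_norm ℓ (Yδ.neg_mem hμ)

/-- A Fortin operator controls the dual norm of a residual by its discrete dual norm, up to data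
oscillation. -/
theorem norm_sub_le_discreteDualNorm_add {Y : Type*} [NormedAddCommGroup Y]
    [InnerProductSpace ℝ Y] {Yδ : Submodule ℝ Y} {Q : Y →L[ℝ] Y} (hran : ∀ μ, Q μ ∈ Yδ)
    (b g : Y →L[ℝ] ℝ) (hb : ∀ μ, b (μ - Q μ) = 0) :
    ‖b - g‖ ≤ ‖Q‖ * discreteDualNorm Yδ (b - g) +
      ‖g.comp (ContinuousLinearMap.id ℝ Y - Q)‖ := by
  have hD := discreteDualNorm_nonneg Yδ (b - g)
  refine ContinuousLinearMap.opNorm_le_bound _ (by positivity) fun μ => ?_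
  have hsplit : (b - g) μ = (b - g) (Q μ) - g.comp (ContinuousLinearMap.id ℝ Y - Q) μ := by
    have := hb μ
    simp only [map_sub] at this
    simp
    linarith
  calc ‖(b - g) μ‖
      ≤ |(b - g) (Q μ)| + ‖g.comp (ContinuousLinearMap.id ℝ Y - Q) μ‖ := by
        rw [hsplit]; exact norm_sub_le _ _
    _ ≤ discreteDualNorm Yδ (b - g) * (‖Q‖ * ‖μ‖) +
          ‖g.comp (ContinuousLinearMap.id ℝ Y - Q)‖ * ‖μ‖ := by
        gcongr
        · exact (abs_le_discreteDualNorm_mul_norm _ (hran μ)).trans (by gcongr; exact Q.le_opNorm μ)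
        · exact ContinuousLinearMap.le_opNorm _ μ
    _ = _ := by ring

theorem sqrt_sq_add_le_mul_sqrt_add {n d o M q c : ℝ} (hn : 0 ≤ n) (hd : 0 ≤ d) (ho : 0 ≤ o)
    (hM : 1 ≤ M) (hq : q ≤ M) (hc : 0 ≤ c) (h : n ≤ q * d + o) :
    √(n ^ 2 + c) ≤ M * √(d ^ 2 + c) + o := by
  have hS : √(d ^ 2 + c) ^ 2 = d ^ 2 + c := Real.sq_sqrt (by positivity)
  have hdS : d ≤ √(d ^ 2 + c) := Real.le_sqrt_of_sq_le (by linarith)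
  have hn' : n ≤ M * d + o := h.trans (by gcongr)
  refine Real.sqrt_le_iff.mpr ⟨by positivity, ?_⟩
  calc n ^ 2 + c ≤ (M * d + o) ^ 2 + M ^ 2 * c := by
        gcongr
        exact le_mul_of_one_le_left hc (one_le_pow₀ hM)
    _ = M ^ 2 * (d ^ 2 + c) + 2 * (M * d) * o + o ^ 2 := by ring
    _ ≤ M ^ 2 * (d ^ 2 + c) + 2 * (M * √(d ^ 2 + c)) * o + o ^ 2 := by gcongr
    _ = (M * √(d ^ 2 + c) + o) ^ 2 := by rw [← hS, Real.sqrt_sq (Real.sqrt_nonneg _)]; ring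

/-- Lemma 3.9: control of `G_ε` by its discretized version plus data oscillation. -/
theorem stmt_11
    {X Y Hω H₀ : Type*}
    [NormedAddCommGroup X] [InnerProductSpace ℝ X] [CompleteSpace X]
    [NormedAddCommGroup Y] [InnerProductSpace ℝ Y] [CompleteSpace Y]
    [NormedAddCommGroup Hω] [InnerProductSpace ℝ Hω] [CompleteSpace Hω]
    [NormedAddCommGroup H₀] [InnerProductSpace ℝ H₀] [CompleteSpace H₀]
    (B : X →L[ℝ] (Y →L[ℝ] ℝ)) (Γ : X →L[ℝ] Hω) (γ₀ : X →L[ℝ] H₀)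
    (g : Y →L[ℝ] ℝ) (f : Hω)
    (Xδ : Submodule ℝ X) (Yδ : Submodule ℝ Y)
    (Q : Y →L[ℝ] Y)
    (hran : ∀ μ : Y, Q μ ∈ Yδ)
    (hFortin : ∀ w ∈ Xδ, ∀ μ : Y, B w (μ - Q μ) = 0) :
    ∀ ε : ℝ, 0 ≤ ε → ∀ w ∈ Xδ,
      Real.sqrt (‖B w - g‖ ^ 2 + ‖Γ w - f‖ ^ 2 + ε ^ 2 * ‖γ₀ w‖ ^ 2) ≤
        max 1 ‖Q‖ *
          Real.sqrt (discreteDualNorm Yδ (B w - g) ^ 2 + ‖Γ w - f‖ ^ 2 +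
            ε ^ 2 * ‖γ₀ w‖ ^ 2) +
        ‖g.comp (ContinuousLinearMap.id ℝ Y - Q)‖ := by
  intro ε _ w hw
  rw [add_assoc, add_assoc]
  exact sqrt_sq_add_le_mul_sqrt_add (norm_nonneg _) (discreteDualNorm_nonneg _ _)
    (norm_nonneg _) (le_max_left _ _) (le_max_right _ _) (by positivity)
    (norm_sub_le_discreteDualNorm_add hran (B w) g (hFortin w hw))
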